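/- Let $X$ be a Banach space and let $f, f_n : X \to \mathbb{R}\cup\{\infty\}$ be proper lower semicontinuous convex functions. Suppose: (i) $\partial f_n$ converges graphically to $\partial f$ in the norm times weak-star topology, i.e., $\mathrm{Ls}_{\|\cdot\|\times w^*}\partial f_n \subseteq \partial f \subseteq \mathrm{Li}_{\|\cdot\|\times w^*}\partial f_n$; (ii) there exist $(a, a^*) \in \partial f$ and $(a_n, a_n^*) \in \partial f_n$ with $a_n \to a$ in norm, $a_n^* \rightharpoonup^* a^*$, and $f_n(a_n) \to f(a)$; and (iii) $\Gamma\text{-}\liminf_n f_n > -\infty$ everywhere. Then $f = \Gamma\text{-}\lim_n f_n$ in the norm topology. -/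

import Mathlib

open Filter Topology

noncomputable section

variable {X : Type*} [NormedAddCommGroup X] [NormedSpace ℝ X]

/-- Fenchel conjugate of `f : X → EReal`, as a function on the dual. -/
def fconj (f : X → EReal) (p : X →L[ℝ] ℝ) : EReal :=
  ⨆ x : X, ((p x : ℝ) : EReal) - f x

/-- `f` is a proper convex lower semicontinuous function with values in `ℝ ∪ {∞}`. -/
def IsPLC (f : X → EReal) : Prop :=
  (∃ x, f x ≠ ⊤) ∧ (∀ x, f x ≠ ⊥) ∧
    Convex ℝ {q : X × ℝ | f q.1 ≤ (q.2 : EReal)} ∧ LowerSemicontinuous f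

/-- Sequential Γ-liminf in the norm topology. -/
def gLiminf (f : ℕ → X → EReal) (x : X) : EReal :=
  ⨅ (u : ℕ → X) (_ : Tendsto u atTop (𝓝 x)), liminf (fun n => f n (u n)) atTop

/-- Sequential Γ-limsup in the norm topology. -/
def gLimsup (f : ℕ → X → EReal) (x : X) : EReal :=
  ⨅ (u : ℕ → X) (_ : Tendsto u atTop (𝓝 x)), limsup (fun n => f n (u n)) atTop

/-- Weak-star convergence of a sequence of continuous linear functionals. -/
def WStarTendsto (u : ℕ → X →L[ℝ] ℝ) (p : X →L[ℝ] ℝ) : Prop :=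
  ∀ x : X, Tendsto (fun n => u n x) atTop (𝓝 (p x))

/-- Sequential Γ-liminf in the weak-star topology of the dual. -/
def gLiminfW (g : ℕ → (X →L[ℝ] ℝ) → EReal) (p : X →L[ℝ] ℝ) : EReal :=
  ⨅ (u : ℕ → X →L[ℝ] ℝ) (_ : WStarTendsto u p), liminf (fun n => g n (u n)) atTop

/-- Sequential Γ-limsup in the weak-star topology of the dual. -/
def gLimsupW (g : ℕ → (X →L[ℝ] ℝ) → EReal) (p : X →L[ℝ] ℝ) : EReal :=
  ⨅ (u : ℕ → X →L[ℝ] ℝ) (_ : WStarTendsto u p), limsup (fun n => g n (u n)) atTop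

/-- Graph of the convex subdifferential. -/
def subdiff (f : X → EReal) : Set (X × (X →L[ℝ] ℝ)) :=
  {q | f q.1 + fconj f q.2 = ((q.2 q.1 : ℝ) : EReal)}

/-- Graph of the Fenchel subdifferential of an arbitrary function. -/
def fenSubdiff (g : X → EReal) : Set (X × (X →L[ℝ] ℝ)) :=
  {q | g q.1 ≠ ⊤ ∧ ∀ u : X, ((q.2 u - q.2 q.1 : ℝ) : EReal) + g q.1 ≤ g u}

/-- Moreau envelope. -/
def moreau (f : X → EReal) (lam : ℝ) (x : X) : EReal :=
  ⨅ y : X, f y + ((1 / (2 * lam) * ‖x - y‖ ^ 2 : ℝ) : EReal)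


/-- Sequential lower limit of the graphs in the norm × weak-star topology. -/
def LiGraph {X : Type*} [NormedAddCommGroup X] [NormedSpace ℝ X]
    (T : ℕ → Set (X × (X →L[ℝ] ℝ))) : Set (X × (X →L[ℝ] ℝ)) :=
  {q | ∃ (xs : ℕ → X) (ps : ℕ → X →L[ℝ] ℝ),
    (∀ᶠ n in atTop, (xs n, ps n) ∈ T n) ∧
    Tendsto xs atTop (𝓝 q.1) ∧ WStarTendsto ps q.2}

/-- Sequential upper limit of the graphs in the norm × weak-star topology. -/
def LsGraph {X : Type*} [NormedAddCommGroup X] [NormedSpace ℝ X]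
    (T : ℕ → Set (X × (X →L[ℝ] ℝ))) : Set (X × (X →L[ℝ] ℝ)) :=
  {q | ∃ j : ℕ → ℕ, StrictMono j ∧ ∃ (xs : ℕ → X) (ps : ℕ → X →L[ℝ] ℝ),
    (∀ n, (xs n, ps n) ∈ T (j n)) ∧
    Tendsto xs atTop (𝓝 q.1) ∧ WStarTendsto ps q.2}

theorem aux_subdiff_iff {E : Type*} [NormedAddCommGroup E] [NormedSpace ℝ E] {f : E → EReal}
    (hf : ∀ x, f x ≠ ⊥) (p : E) (ps : E →L[ℝ] ℝ) :
    (p, ps) ∈ subdiff f ↔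
      f p ≠ ⊤ ∧ ∀ v, f v ≠ ⊤ → (f p).toReal + ps (v - p) ≤ (f v).toReal := by
  constructor
  · intro h
    have h1 : f p + fconj f ps = ((ps p : ℝ) : EReal) := h
    have hp : f p ≠ ⊤ := by
      intro ht
      rw [ht] at h1
      rcases eq_or_ne (fconj f ps) ⊥ with h2 | h2
      · rw [h2, EReal.add_bot] at h1
        exact EReal.bot_ne_coe _ h1
      · rw [EReal.top_add_of_ne_bot h2] at h1
        exact EReal.top_ne_coe _ h1
    refine ⟨hp, fun v hv => ?_⟩
    have h3 : ((ps v : ℝ) : EReal) - f v ≤ fconj f ps :=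
      le_iSup (fun x : E => ((ps x : ℝ) : EReal) - f x) v
    lift f p to ℝ using ⟨hp, hf p⟩ with a
    lift f v to ℝ using ⟨hv, hf v⟩ with b
    induction hc : fconj f ps with
    | bot => rw [hc, EReal.add_bot] at h1; exact absurd h1 (EReal.bot_ne_coe _)
    | top => rw [hc, EReal.coe_add_top] at h1; exact absurd h1 (EReal.top_ne_coe _)
    | coe c =>
      rw [hc] at h1 h3
      norm_cast at h1 h3
      simp only [EReal.toReal_coe, map_sub]
      linarith
  · rintro ⟨hp, h⟩
    have h2 : fconj f ps = ((ps p - (f p).toReal : ℝ) : EReal) := by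
      apply le_antisymm
      · apply iSup_le
        intro v
        rcases eq_or_ne (f v) ⊤ with hv | hv
        · rw [hv]; simp
        · have h3 := h v hv
          lift f v to ℝ using ⟨hv, hf v⟩ with b
          norm_cast
          simp only [EReal.toReal_coe, map_sub] at h3
          linarith
      · have h3 : ((ps p : ℝ) : EReal) - f p ≤ fconj f ps :=
          le_iSup (fun x : E => ((ps x : ℝ) : EReal) - f x) p
        lift f p to ℝ using ⟨hp, hf p⟩ with a
        simpa using h3
    show f p + fconj f ps = ((ps p : ℝ) : EReal)
    rw [h2]
    lift f p to ℝ using ⟨hp, hf p⟩ with a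
    rw [EReal.toReal_coe]
    norm_cast
    ring

theorem aux_ekeland {E : Type*} [MetricSpace E] [CompleteSpace E] (D : Set E) (F : E → ℝ)
    (m : ℝ) (hm : ∀ x ∈ D, m ≤ F x)
    (hl : ∀ (c : ℝ) (u : ℕ → E) (u0 : E), Tendsto u atTop (𝓝 u0) →
      (∀ n, u n ∈ D ∧ F (u n) ≤ c) → u0 ∈ D ∧ F u0 ≤ c)
    (x0 : E) (hx0 : x0 ∈ D) (ε : ℝ) (hε : 0 < ε) :
    ∃ p ∈ D, F p ≤ F x0 ∧ ∀ v ∈ D, F p ≤ F v + ε * dist v p := by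
  -- one step
  have step : ∀ (n : ℕ) (x : D), ∃ y : D, F y + ε * dist (y : E) x ≤ F x ∧
      ∀ v ∈ D, F v + ε * dist v (x : E) ≤ F x → F y - 1 / ((n : ℝ) + 1) ≤ F v := by
    intro n x
    let S : Set ℝ := F '' {v | v ∈ D ∧ F v + ε * dist v (x : E) ≤ F x}
    have hS : S.Nonempty := ⟨F x, x, ⟨x.2, by simp⟩, rfl⟩
    have hb : BddBelow S := ⟨m, by rintro _ ⟨v, hv, rfl⟩; exact hm v hv.1⟩
    have hpos : (0 : ℝ) < 1 / ((n : ℝ) + 1) := by positivity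
    obtain ⟨_, ⟨y, hy, rfl⟩, hlt⟩ := exists_lt_of_csInf_lt hS (lt_add_of_pos_right (sInf S) hpos)
    refine ⟨⟨y, hy.1⟩, hy.2, fun v hv hv2 => ?_⟩
    have := csInf_le hb ⟨v, ⟨hv, hv2⟩, rfl⟩
    simp only
    linarith
  choose g hg1 hg2 using step
  let x : ℕ → D := fun n => Nat.rec (motive := fun _ => D) ⟨x0, hx0⟩ (fun n y => g n y) n
  have hx1 : ∀ n : ℕ, F (x (n+1)).1 + ε * dist (x (n+1)).1 (x n).1 ≤ F (x n).1 := by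
    intro n
    exact hg1 n (x n)
  have hx2 : ∀ n : ℕ, ∀ v ∈ D, F v + ε * dist v (x n : E) ≤ F (x n) →
      F (x (n+1)) - 1 / ((n : ℝ) + 1) ≤ F v := fun n => hg2 n (x n)
  have hx3 : ∀ n k : ℕ, F (x (n+k)) + ε * dist (x (n+k) : E) (x n) ≤ F (x n) := by
    intro n k
    induction k with
    | zero => simp
    | succ k ih =>
      have h1 := hx1 (n+k)
      have h2 := dist_triangle (x (n+k+1) : E) (x (n+k)) (x n)
      have h3 := mul_le_mul_of_nonneg_left h2 hε.le
      rw [← add_assoc]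
      linarith
  have hanti : Antitone (fun n => F (x n)) := by
    apply antitone_nat_of_succ_le
    intro n
    have := hx1 n
    have : 0 ≤ ε * dist (x (n+1) : E) (x n) := by positivity
    linarith
  have hbd : BddBelow (Set.range (fun n => F (x n))) :=
    ⟨m, by rintro _ ⟨n, rfl⟩; exact hm _ (x n).2⟩
  have hlim := tendsto_atTop_ciInf hanti hbd
  set l := ⨅ n, F (x n) with hldef
  have hll : ∀ n, l ≤ F (x n) := fun n => ciInf_le hbd n
  have hcau : CauchySeq (fun n => (x n : E)) := by
    apply cauchySeq_of_le_tendsto_0' (fun n => (F (x n) - l) / ε)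
    · intro n k hnk
      obtain ⟨j, rfl⟩ := Nat.exists_eq_add_of_le hnk
      have h1 := hx3 n j
      have h2 := hll (n + j)
      rw [le_div_iff₀ hε, dist_comm]
      linarith
    · have := (hlim.sub_const l).div_const ε
      simpa using this
  obtain ⟨p, hp⟩ := cauchySeq_tendsto_of_complete hcau
  have hpn : ∀ n, p ∈ D ∧ F p ≤ F (x n) := by
    intro n
    apply hl (F (x n)) (fun k => (x (k + n) : E)) p
    · exact (tendsto_add_atTop_iff_nat n).2 hp
    · intro k
      exact ⟨(x (k+n)).2, hanti (by omega)⟩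
  have hpl : F p ≤ l := le_ciInf fun n => (hpn n).2
  have hlx : ∀ n, l + ε * dist p (x n : E) ≤ F (x n) := by
    intro n
    have h1 : Tendsto (fun k => l + ε * dist (x k : E) (x n : E)) atTop
        (𝓝 (l + ε * dist p (x n : E))) :=
      ((hp.dist tendsto_const_nhds).const_mul ε).const_add l
    apply le_of_tendsto h1
    filter_upwards [eventually_ge_atTop n] with k hk
    obtain ⟨j, rfl⟩ := Nat.exists_eq_add_of_le hk
    linarith [hx3 n j, hll (n+j)]
  refine ⟨p, (hpn 0).1, (hpn 0).2, fun v hv => ?_⟩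
  by_contra hcon
  push Not at hcon
  have h1 : ∀ n : ℕ, F (x (n+1)) - 1 / ((n : ℝ) + 1) ≤ F v := by
    intro n
    apply hx2 n v hv
    have h2 := mul_le_mul_of_nonneg_left (dist_triangle v p (x n : E)) hε.le
    linarith [hlx n]
  have h2 : Tendsto (fun n : ℕ => F (x (n+1)) - 1 / ((n : ℝ) + 1)) atTop (𝓝 (l - 0)) :=
    ((tendsto_add_atTop_iff_nat 1).2 hlim).sub tendsto_one_div_add_atTop_nhds_zero_nat
  have h3 : l - 0 ≤ F v := le_of_tendsto' h2 h1
  have : 0 ≤ ε * dist v p := by positivity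
  linarith

theorem aux_approx {E : Type*} [NormedAddCommGroup E] [NormedSpace ℝ E] [CompleteSpace E]
    {f : E → EReal} (hf : IsPLC f) (z : E) (K ε m : ℝ) (hK : 0 ≤ K) (hε : 0 < ε)
    (x0 : E) (hx0 : f x0 ≠ ⊤) (hm : ∀ v, f v ≠ ⊤ → m ≤ (f v).toReal + K * ‖z - v‖) :
    ∃ q : E × (E →L[ℝ] ℝ), q ∈ subdiff f ∧
      (f q.1).toReal + K * ‖z - q.1‖ ≤ (f x0).toReal + K * ‖z - x0‖ ∧
      (∀ h, q.2 h ≤ (K + ε) * ‖h‖) ∧ (K - ε) * ‖z - q.1‖ ≤ q.2 (z - q.1) := by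
  obtain ⟨-, hbot, hconv, hlsc⟩ := hf
  obtain ⟨p, hpD, hp0, hpmin⟩ := aux_ekeland {v | f v ≠ ⊤}
    (fun v => (f v).toReal + K * ‖z - v‖) m hm (by
      intro c u u0 hu hn
      have hcl := hlsc.isClosed_epigraph
      have ht : Tendsto (fun n => (u n, ((c - K * ‖z - u n‖ : ℝ) : EReal))) atTop
          (𝓝 (u0, ((c - K * ‖z - u0‖ : ℝ) : EReal))) := by
        apply hu.prodMk_nhds
        apply (continuous_coe_real_ereal.tendsto _).comp
        exact (((tendsto_const_nhds.sub hu).norm).const_mul K).const_sub c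
      have hmem := hcl.mem_of_tendsto ht (Eventually.of_forall (fun n => by
        obtain ⟨h1, h2⟩ := hn n
        simp only [Set.mem_ofPred_eq] at h1 h2 ⊢
        rw [← EReal.coe_toReal h1 (hbot _)]
        norm_cast
        linarith))
      simp only [Set.mem_ofPred_eq] at hmem ⊢
      have hne : f u0 ≠ ⊤ := fun h => by
        rw [h, top_le_iff] at hmem
        exact EReal.coe_ne_top _ hmem
      refine ⟨hne, ?_⟩
      rw [← EReal.coe_toReal hne (hbot _)] at hmem
      norm_cast at hmem
      linarith) x0 hx0 ε hε
  simp only [Set.mem_ofPred_eq] at hpD hp0 hpmin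
  set k : E → ℝ := fun v =>
    ((f p).toReal + K * ‖z - p‖) - (K * ‖z - v‖ + ε * ‖v - p‖) with hk
  have hkc : Continuous k := by fun_prop
  have hkp : k p = (f p).toReal := by simp [hk]
  have hkconc : ConcaveOn ℝ Set.univ k := by
    refine ⟨convex_univ, fun u _ v _ s t hs ht hst => ?_⟩
    have e1 : z - (s • u + t • v) = s • (z - u) + t • (z - v) := by
      rw [smul_sub, smul_sub, ← sub_eq_zero]
      have : z = s • z + t • z := by rw [← add_smul, hst, one_smul]
      nth_rewrite 1 [this]; abel
    have e2 : (s • u + t • v) - p = s • (u - p) + t • (v - p) := by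
      rw [smul_sub, smul_sub, ← sub_eq_zero]
      have : p = s • p + t • p := by rw [← add_smul, hst, one_smul]
      nth_rewrite 1 [this]; abel
    have n1 : ‖z - (s • u + t • v)‖ ≤ s * ‖z - u‖ + t * ‖z - v‖ := by
      rw [e1]
      refine (norm_add_le _ _).trans ?_
      rw [norm_smul, norm_smul, Real.norm_of_nonneg hs, Real.norm_of_nonneg ht]
    have n2 : ‖(s • u + t • v) - p‖ ≤ s * ‖u - p‖ + t * ‖v - p‖ := by
      rw [e2]
      refine (norm_add_le _ _).trans ?_
      rw [norm_smul, norm_smul, Real.norm_of_nonneg hs, Real.norm_of_nonneg ht]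
    have m1 := mul_le_mul_of_nonneg_left n1 hK
    have m2 := mul_le_mul_of_nonneg_left n2 hε.le
    simp only [hk, smul_eq_mul]
    have : t = 1 - s := by linarith
    subst this
    linarith
  have hA1 : Convex ℝ {q : E × ℝ | q.2 < k q.1} := by
    have := hkconc.convex_strict_hypograph
    simpa using this
  have hA2 : IsOpen {q : E × ℝ | q.2 < k q.1} :=
    isOpen_lt continuous_snd (hkc.comp continuous_fst)
  have hdisj : Disjoint {q : E × ℝ | q.2 < k q.1} {q : E × ℝ | f q.1 ≤ (q.2 : EReal)} := by
    rw [Set.disjoint_left]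
    rintro ⟨v, r⟩ h1 h2
    simp only [Set.mem_ofPred_eq] at h1 h2
    have hne : f v ≠ ⊤ := fun h => by
      rw [h, top_le_iff] at h2
      exact EReal.coe_ne_top _ h2
    rw [← EReal.coe_toReal hne (hbot _)] at h2
    norm_cast at h2
    have h3 := hpmin v hne
    rw [dist_eq_norm] at h3
    simp only [hk] at h1
    linarith
  obtain ⟨L, c, hL1, hL2⟩ := geometric_hahn_banach_open hA1 hA2 hconv hdisj
  set α := L (0, 1) with hα
  set ℓ : E →L[ℝ] ℝ := L.comp (ContinuousLinearMap.inl ℝ E ℝ) with hℓ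
  have hLdec : ∀ v r, L (v, r) = ℓ v + r * α := by
    intro v r
    have : ((v, r) : E × ℝ) = (v, 0) + r • ((0 : E), (1 : ℝ)) := by simp
    rw [this, map_add, map_smul]
    simp [hℓ, hα]
  have hB : ∀ v, f v ≠ ⊤ → c ≤ ℓ v + (f v).toReal * α := by
    intro v hv
    rw [← hLdec]
    apply hL2
    simp only [Set.mem_ofPred_eq]
    rw [EReal.coe_toReal hv (hbot _)]
  have hA : ∀ v r, r < k v → ℓ v + r * α < c := by
    intro v r hr
    rw [← hLdec]
    exact hL1 _ hr
  have hA' : ∀ v, ℓ v + k v * α ≤ c := by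
    intro v
    have ht : Tendsto (fun r : ℝ => ℓ v + r * α) (𝓝[<] (k v)) (𝓝 (ℓ v + k v * α)) := by
      apply Tendsto.mono_left _ nhdsWithin_le_nhds
      exact Continuous.tendsto (by fun_prop) _
    apply le_of_tendsto ht
    filter_upwards [self_mem_nhdsWithin] with r hr
    exact (hA v r hr).le
  have hαpos : 0 < α := by
    have h1 := hB p hpD
    have h2 := hA p ((f p).toReal - 1) (by rw [hkp]; linarith)
    linarith
  have hsl : ∀ h, (-(α⁻¹ • ℓ)) h * α = - ℓ h := by
    intro h
    simp only [_root_.neg_apply, _root_.smul_apply, smul_eq_mul]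
    field_simp
  set ps : E →L[ℝ] ℝ := -(α⁻¹ • ℓ) with hps
  have hcp : c = ℓ p + (f p).toReal * α := le_antisymm (hB p hpD) (by rw [← hkp]; exact hA' p)
  have hk2 : ∀ v, k v ≤ (f p).toReal + ps (v - p) := by
    intro v
    have h1 := hA' v
    have h2 := hsl (v - p)
    rw [map_sub ℓ] at h2
    apply le_of_mul_le_mul_right _ hαpos
    rw [add_mul, h2]
    linarith
  refine ⟨(p, ps), (aux_subdiff_iff hbot p ps).2 ⟨hpD, fun v hv => ?_⟩, hp0, fun h => ?_, ?_⟩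
  · have h1 := hB v hv
    have h2 := hsl (v - p)
    rw [map_sub ℓ] at h2
    apply le_of_mul_le_mul_right _ hαpos
    rw [add_mul, h2]
    linarith
  · have h1 := hk2 (p - h)
    have h2 : ‖z - (p - h)‖ ≤ ‖z - p‖ + ‖h‖ := by
      rw [show z - (p - h) = (z - p) + h by abel]; exact norm_add_le _ _
    have h3 := mul_le_mul_of_nonneg_left h2 hK
    simp only [hk, sub_sub_cancel_left, norm_neg, map_neg] at h1
    show ps h ≤ _
    linarith
  · have h1 := hk2 z
    simp only [hk, sub_self, norm_zero, mul_zero] at h1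
    show (K - ε) * ‖z - p‖ ≤ ps (z - p)
    linarith

theorem aux_lower {E : Type*} [NormedAddCommGroup E] [NormedSpace ℝ E] 
    {f : E → EReal} (hbot : ∀ x, f x ≠ ⊥) (q : E × (E →L[ℝ] ℝ)) (hq : q ∈ subdiff f) (z v : E)
    (hv : f v ≠ ⊤) :
    (f q.1).toReal - ‖q.2‖ * ‖z - q.1‖ - ‖q.2‖ * ‖z - v‖ ≤ (f v).toReal := by
  have h1 := ((aux_subdiff_iff hbot q.1 q.2).1 hq).2 v hv
  have h2 : -(q.2 (v - q.1)) ≤ ‖q.2‖ * ‖v - q.1‖ :=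
    (neg_le_abs _).trans (q.2.le_opNorm _)
  have h3 : ‖v - q.1‖ ≤ ‖z - q.1‖ + ‖z - v‖ := by
    rw [show v - q.1 = (z - q.1) - (z - v) by abel]; exact norm_sub_le _ _
  have h4 := mul_le_mul_of_nonneg_left h3 (norm_nonneg q.2)
  linarith

theorem aux_approx' {E : Type*} [NormedAddCommGroup E] [NormedSpace ℝ E] [CompleteSpace E]
    {f : E → EReal} (hf : IsPLC f) (a : E × (E →L[ℝ] ℝ)) (ha : a ∈ subdiff f)
    (z : E) (K ε : ℝ) (hK : ‖a.2‖ ≤ K) (hε : 0 < ε)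
    (x0 : E) (hx0 : f x0 ≠ ⊤) :
    ∃ q : E × (E →L[ℝ] ℝ), q ∈ subdiff f ∧
      (f q.1).toReal + K * ‖z - q.1‖ ≤ (f x0).toReal + K * ‖z - x0‖ ∧
      (∀ h, q.2 h ≤ (K + ε) * ‖h‖) ∧ (K - ε) * ‖z - q.1‖ ≤ q.2 (z - q.1) := by
  apply aux_approx hf z K ε ((f a.1).toReal - ‖a.2‖ * ‖z - a.1‖) ((norm_nonneg _).trans hK) hε
    x0 hx0
  intro v hv
  have h1 := aux_lower hf.2.1 a ha z v hv
  have h2 := mul_le_mul_of_nonneg_right hK (norm_nonneg (z - v))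
  linarith

theorem aux_chain {E : Type*} [NormedAddCommGroup E] [NormedSpace ℝ E] [CompleteSpace E]
    {f : E → EReal} (hf : IsPLC f) (V : ℕ → (E × (E →L[ℝ] ℝ)) → ℝ)
    (hV : ∀ q ∈ subdiff f, ∀ q' ∈ subdiff f, ∀ δ > 0,
      ∀ᶠ n in atTop, q.2 (q'.1 - q.1) - δ ≤ V n q' - V n q)
    (q q' : E × (E →L[ℝ] ℝ)) (hq : q ∈ subdiff f) (hq' : q' ∈ subdiff f) (δ : ℝ) (hδ : 0 < δ) :
    ∀ᶠ n in atTop, (f q'.1).toReal - (f q.1).toReal - δ ≤ V n q' - V n q := by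
  have hbot := hf.2.1
  set d := ‖q'.1 - q.1‖ with hd
  have hd0 : 0 ≤ d := norm_nonneg _
  set K := max ‖q.2‖ ‖q'.2‖ + 1 with hKdef
  have hK1 : ‖q.2‖ + 1 ≤ K := by
    have := le_max_left ‖q.2‖ ‖q'.2‖
    linarith
  have hK2 : ‖q'.2‖ + 1 ≤ K := by
    have := le_max_right ‖q.2‖ ‖q'.2‖
    linarith
  have hK0 : 0 < K := by have := norm_nonneg q.2; linarith
  set R := 2 * K * d with hR
  have hR0 : 0 ≤ R := by positivity
  obtain ⟨N0, hN0⟩ := exists_nat_gt (4 * K * d / δ)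
  set N := N0 + 1 with hN
  have hNpos : (0 : ℝ) < N := by rw [hN]; positivity
  have hNbig : 2 * K * d / N ≤ δ / 2 := by
    rw [div_lt_iff₀ hδ] at hN0
    rw [div_le_iff₀ hNpos]
    have : (N : ℝ) = N0 + 1 := by rw [hN]; push_cast; ring
    rw [this]
    linarith
  set ε := δ / (2 * N * (4 * R + 1)) with hεdef
  have hε : 0 < ε := by positivity
  have hεN : (N : ℝ) * (4 * ε * R + ε) = δ / 2 := by
    rw [hεdef]; field_simp
  set w := q'.1 - q.1 with hw
  set z : ℕ → E := fun i => q.1 + ((i : ℝ) / N) • w with hz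
  have hzN : z N = q'.1 := by
    simp only [hz]
    rw [div_self hNpos.ne', one_smul, hw]; abel
  have hz0 : z 0 = q.1 := by simp [hz]
  have hzs : ∀ i, z (i+1) - z i = (1 / (N:ℝ)) • w := by
    intro i
    simp only [hz]
    rw [add_sub_add_left_eq_sub, ← sub_smul]
    congr 1
    push_cast
    ring
  have hfq := ((aux_subdiff_iff hbot q.1 q.2).1 hq).1
  have hex : ∀ i : ℕ, ∃ P : E × (E →L[ℝ] ℝ), P ∈ subdiff f ∧ (i = 0 → P = q) ∧ (i = N → P = q') ∧
      (i ≤ N → (∀ h, P.2 h ≤ (K + ε) * ‖h‖) ∧ (K - ε) * ‖z i - P.1‖ ≤ P.2 (z i - P.1) ∧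
        ‖z i - P.1‖ ≤ R) := by
    intro i
    have hbd : ∀ (P : E →L[ℝ] ℝ), ‖P‖ + 1 ≤ K → ∀ h, P h ≤ (K + ε) * ‖h‖ := by
      intro P hP h
      refine (le_abs_self _).trans ((P.le_opNorm h).trans ?_)
      apply mul_le_mul_of_nonneg_right _ (norm_nonneg _)
      linarith
    rcases Nat.eq_zero_or_pos i with h0 | h0
    · refine ⟨q, hq, fun _ => rfl, fun h => by omega, fun _ => ⟨hbd _ hK1, ?_, ?_⟩⟩
      · rw [h0, hz0]; simp
      · rw [h0, hz0]; simpa using hR0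
    rcases eq_or_ne i N with h1 | h1
    · refine ⟨q', hq', fun h => by omega, fun _ => rfl, fun _ => ⟨hbd _ hK2, ?_, ?_⟩⟩
      · rw [h1, hzN]; simp
      · rw [h1, hzN]; simpa using hR0
    by_cases h2 : i ≤ N
    swap
    · exact ⟨q, hq, fun _ => rfl, fun h => absurd h h1, fun h => absurd h h2⟩
    obtain ⟨P, hP, hP1, hP2, hP3⟩ := aux_approx' hf q hq (z i) K ε (by linarith) hε q.1 hfq
    refine ⟨P, hP, fun h => by omega, fun h => absurd h h1, fun _ => ⟨hP2, hP3, ?_⟩⟩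
    have h3 : ‖z i - q.1‖ ≤ d := by
      simp only [hz, add_sub_cancel_left]
      rw [norm_smul, Real.norm_of_nonneg (by positivity)]
      have : (i : ℝ) / N ≤ 1 := by
        rw [div_le_one hNpos]; exact_mod_cast h2
      calc _ ≤ 1 * ‖w‖ := mul_le_mul_of_nonneg_right this (norm_nonneg _)
        _ = d := one_mul _
    have h4 := aux_lower hbot q hq (z i) P.1 ((aux_subdiff_iff hbot P.1 P.2).1 hP).1
    have h5 : 1 * ‖z i - P.1‖ ≤ (K - ‖q.2‖) * ‖z i - P.1‖ :=
      mul_le_mul_of_nonneg_right (by linarith) (norm_nonneg _)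
    have h6 : (K + ‖q.2‖) * ‖z i - q.1‖ ≤ (2 * K) * d := by
      apply mul_le_mul (by linarith) h3 (norm_nonneg _) (by positivity)
    rw [hR]
    linarith
  choose P hPs hP0 hPN hPi using hex
  have key : ∀ i, i ≤ N → ∀ᶠ n in atTop, (f (P i).1).toReal - (f q.1).toReal
      - ((P i).2 - q.2) ((1 / (N : ℝ)) • w) - i * (4 * ε * R + ε) ≤ V n (P i) - V n q := by
    intro i
    induction i with
    | zero =>
      intro _
      rw [hP0 0 rfl]
      simp
    | succ i ih =>
      intro hi
      filter_upwards [ih (by omega), hV (P i) (hPs i) (P (i+1)) (hPs (i+1)) ε hε] with n h1 h2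
      obtain ⟨a1, a2, a3⟩ := hPi i (by omega)
      obtain ⟨b1, b2, b3⟩ := hPi (i+1) hi
      have hsub := ((aux_subdiff_iff hbot (P (i+1)).1 (P (i+1)).2).1 (hPs (i+1))).2 (P i).1
        ((aux_subdiff_iff hbot (P i).1 (P i).2).1 (hPs i)).1
      have c1 := a1 (z (i+1) - (P (i+1)).1)
      have c2 := b1 (z i - (P i).1)
      have e1 := mul_le_mul_of_nonneg_left a3 hε.le
      have e2 := mul_le_mul_of_nonneg_left b3 hε.le
      have g1 := congrArg (P i).2 (hzs i)
      have g2 := congrArg (P (i+1)).2 (hzs i)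
      simp only [_root_.sub_apply] at h1 ⊢
      simp only [map_sub] at a2 b2 c1 c2 hsub g1 g2 h2
      push_cast
      nlinarith
  filter_upwards [key N le_rfl] with n hn
  rw [hPN N rfl] at hn
  have h1 : (q'.2 - q.2) ((1 / (N : ℝ)) • w) ≤ 2 * K * d / N := by
    rw [map_smul, smul_eq_mul]
    have h2 : (q'.2 - q.2) w ≤ 2 * K * d := by
      refine (le_abs_self _).trans (((q'.2 - q.2).le_opNorm w).trans ?_)
      apply mul_le_mul_of_nonneg_right _ (norm_nonneg _)
      have := norm_sub_le q'.2 q.2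
      linarith
    rw [one_div_mul_eq_div]
    gcongr
  linarith

theorem aux_pairing {E : Type*} [NormedAddCommGroup E] [NormedSpace ℝ E] [CompleteSpace E]
    (ps : ℕ → E →L[ℝ] ℝ) (p : E →L[ℝ] ℝ) (hps : WStarTendsto ps p) (xs : ℕ → E) (x : E)
    (hx : Tendsto xs atTop (𝓝 x)) : Tendsto (fun n => ps n (xs n)) atTop (𝓝 (p x)) := by
  obtain ⟨C, hC⟩ := banach_steinhaus (g := ps) (fun y => by
    obtain ⟨C, hC⟩ := (hps y).norm.bddAbove_range
    exact ⟨C, fun n => hC ⟨n, rfl⟩⟩)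
  have h1 : Tendsto (fun n => ps n (xs n - x)) atTop (𝓝 0) := by
    apply squeeze_zero_norm (a := fun n => C * ‖xs n - x‖)
    · intro n
      exact ((ps n).le_opNorm _).trans (mul_le_mul_of_nonneg_right (hC n) (norm_nonneg _))
    · have := ((hx.sub_const x).norm).const_mul C
      simpa using this
  have h2 := h1.add (hps x)
  simpa using h2

theorem aux_diag {E : Type*} [NormedAddCommGroup E] (fs : ℕ → E → EReal) (x : E) (c : ℝ)
    (h : ∀ δ > 0, ∀ᶠ n in atTop, ∃ v, ‖v - x‖ ≤ δ ∧ fs n v ≤ ((c + δ : ℝ) : EReal)) :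
    ∃ u : ℕ → E, Tendsto u atTop (𝓝 x) ∧ ∀ δ > 0, ∀ᶠ n in atTop, 
      fs n (u n) ≤ ((c + δ : ℝ) : EReal) := by
  classical
  let Q : ℕ → ℕ → Prop := fun n k => ∃ v, ‖v - x‖ ≤ 1 / ((k : ℝ) + 1) ∧
    fs n v ≤ ((c + 1 / ((k : ℝ) + 1) : ℝ) : EReal)
  have hQ : ∀ k, ∀ᶠ n in atTop, Q n k := fun k => h _ (by positivity)
  let κ : ℕ → ℕ := fun n => Nat.findGreatest (Q n) n
  let u : ℕ → E := fun n => if hn : Q n (κ n) then hn.choose else x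
  have hu : ∀ k : ℕ, ∀ᶠ n in atTop, ‖u n - x‖ ≤ 1 / ((k : ℝ) + 1) ∧
      fs n (u n) ≤ ((c + 1 / ((k : ℝ) + 1) : ℝ) : EReal) := by
    intro k
    filter_upwards [hQ k, eventually_ge_atTop k] with n hn hk
    have h1 : Q n (κ n) := Nat.findGreatest_spec hk hn
    have h2 : k ≤ κ n := Nat.le_findGreatest hk hn
    have h3 := h1.choose_spec
    have h4 : u n = h1.choose := dif_pos h1
    have h5 : 1 / ((κ n : ℝ) + 1) ≤ 1 / ((k : ℝ) + 1) := by
      apply one_div_le_one_div_of_le (by positivity)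
      have : (k : ℝ) ≤ κ n := by exact_mod_cast h2
      linarith
    rw [h4]
    refine ⟨h3.1.trans h5, h3.2.trans ?_⟩
    rw [EReal.coe_le_coe_iff]
    linarith
  refine ⟨u, ?_, fun δ hδ => ?_⟩
  · rw [Metric.tendsto_nhds]
    intro δ hδ
    obtain ⟨k, hk⟩ := exists_nat_one_div_lt hδ
    filter_upwards [hu k] with n hn
    rw [dist_eq_norm]
    exact hn.1.trans_lt hk
  · obtain ⟨k, hk⟩ := exists_nat_one_div_lt hδ
    filter_upwards [hu k] with n hn
    refine hn.2.trans ?_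
    rw [EReal.coe_le_coe_iff]
    linarith

/-- Graphical convergence of subdifferentials plus a normalization condition imply
norm Γ-convergence. -/
theorem stmt18 {X : Type*} [NormedAddCommGroup X] [NormedSpace ℝ X] [CompleteSpace X]
    (f : X → EReal) (hf : IsPLC f)
    (fs : ℕ → X → EReal) (hfs : ∀ n, IsPLC (fs n))
    (hLs : LsGraph (fun n => subdiff (fs n)) ⊆ subdiff f)
    (hLi : subdiff f ⊆ LiGraph (fun n => subdiff (fs n)))
    (hnorm : ∃ (a : X) (astar : X →L[ℝ] ℝ) (as : ℕ → X) (ps : ℕ → X →L[ℝ] ℝ),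
      (a, astar) ∈ subdiff f ∧ (∀ n, (as n, ps n) ∈ subdiff (fs n)) ∧
      Tendsto as atTop (𝓝 a) ∧ WStarTendsto ps astar ∧
      Tendsto (fun n => fs n (as n)) atTop (𝓝 (f a)))
    (hliminf : ∀ x : X, ⊥ < gLiminf fs x) :
    ∀ x : X, gLiminf fs x = f x ∧ gLimsup fs x = f x := by
  obtain ⟨a, astar, as, ps0, ha, hasub, has, hps0, hval⟩ := hnorm
  have hbot := hf.2.1
  have hfa := ((aux_subdiff_iff hbot a astar).1 ha).1
  -- recovery sequences
  have hex : ∀ q : X × (X →L[ℝ] ℝ), ∃ (xs : ℕ → X) (ps : ℕ → X →L[ℝ] ℝ), q ∈ subdiff f →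
      ((∀ᶠ n in atTop, (xs n, ps n) ∈ subdiff (fs n)) ∧
      Tendsto xs atTop (𝓝 q.1) ∧ WStarTendsto ps q.2) ∧ (q = (a, astar) → xs = as) := by
    intro q
    by_cases h1 : q = (a, astar)
    · subst h1
      exact ⟨as, ps0, fun _ => ⟨⟨Eventually.of_forall hasub, has, hps0⟩, fun _ => rfl⟩⟩
    · by_cases h2 : q ∈ subdiff f
      · obtain ⟨xs, ps, h⟩ := hLi h2
        exact ⟨xs, ps, fun _ => ⟨h, fun h => absurd h h1⟩⟩
      · exact ⟨as, ps0, fun h => absurd h h2⟩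
  choose xs ps hxp using hex
  set V : ℕ → (X × (X →L[ℝ] ℝ)) → ℝ := fun n q => (fs n (xs q n)).toReal with hVdef
  have hfin : ∀ q ∈ subdiff f, ∀ᶠ n in atTop, fs n (xs q n) ≠ ⊤ := by
    intro q hq
    filter_upwards [(hxp q hq).1.1] with n hn
    exact ((aux_subdiff_iff (hfs n).2.1 _ _).1 hn).1
  have hV : ∀ q ∈ subdiff f, ∀ q' ∈ subdiff f, ∀ δ > 0,
      ∀ᶠ n in atTop, q.2 (q'.1 - q.1) - δ ≤ V n q' - V n q := by
    intro q hq q' hq' δ hδ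
    have h1 := aux_pairing (ps q) q.2 (hxp q hq).1.2.2 (fun n => xs q' n - xs q n) (q'.1 - q.1)
      ((hxp q' hq').1.2.1.sub (hxp q hq).1.2.1)
    filter_upwards [(hxp q hq).1.1, hfin q' hq', h1.eventually (lt_mem_nhds (sub_lt_self _ hδ))]
      with n h2 h3 h4
    have h5 := ((aux_subdiff_iff (hfs n).2.1 _ _).1 h2).2 _ h3
    simp only [hVdef]
    linarith
  have hVa : Tendsto (fun n => V n (a, astar)) atTop (𝓝 (f a).toReal) := by
    simp only [hVdef]
    rw [(hxp (a, astar) ha).2 rfl]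
    exact (EReal.tendsto_toReal hfa (hbot a)).comp hval
  have hVlow : ∀ q ∈ subdiff f, ∀ δ > 0, ∀ᶠ n in atTop, (f q.1).toReal - δ ≤ V n q := by
    intro q hq δ hδ
    filter_upwards [aux_chain hf V hV (a, astar) q ha hq (δ/2) (by positivity),
      hVa.eventually (lt_mem_nhds (sub_lt_self _ (half_pos hδ)))] with n h1 h2
    linarith
  have hVup : ∀ q ∈ subdiff f, ∀ δ > 0, ∀ᶠ n in atTop, V n q ≤ (f q.1).toReal + δ := by
    intro q hq δ hδ
    filter_upwards [aux_chain hf V hV q (a, astar) hq ha (δ/2) (by positivity),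
      hVa.eventually (gt_mem_nhds (lt_add_of_pos_right _ (half_pos hδ)))] with n h1 h2
    linarith
  have hle : ∀ x, gLiminf fs x ≤ gLimsup fs x := fun x =>
    iInf₂_mono fun u _ => liminf_le_limsup
  have hinf : ∀ x, f x ≤ gLiminf fs x := by
    intro x
    refine le_iInf₂ fun u hu => ?_
    -- affine minorants pass to the limit
    have haff : ∀ q ∈ subdiff f, (((f q.1).toReal + q.2 (x - q.1) : ℝ) : EReal) ≤
        liminf (fun n => fs n (u n)) atTop := by
      intro q hq
      have h1 := aux_pairing (ps q) q.2 (hxp q hq).1.2.2 (fun n => u n - xs q n) (x - q.1)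
        (hu.sub (hxp q hq).1.2.1)
      apply EReal.ge_of_forall_gt_iff_ge.1
      intro r hr
      have hr' : r < (f q.1).toReal + q.2 (x - q.1) := by exact_mod_cast hr
      set δ := ((f q.1).toReal + q.2 (x - q.1) - r) / 2 with hδ
      have hδ0 : 0 < δ := by rw [hδ]; linarith
      apply le_liminf_of_le
      · isBoundedDefault
      filter_upwards [hVlow q hq δ hδ0, (hxp q hq).1.1,
        h1.eventually (lt_mem_nhds (sub_lt_self _ hδ0))] with n h2 h3 h4
      rcases eq_or_ne (fs n (u n)) ⊤ with h5 | h5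
      · rw [h5]; exact le_top
      have h6 := ((aux_subdiff_iff (hfs n).2.1 _ _).1 h3).2 _ h5
      rw [← EReal.coe_toReal h5 ((hfs n).2.1 _)]
      norm_cast
      simp only [hVdef] at h2
      linarith
    by_contra hcon
    push Not at hcon
    obtain ⟨M, hM1, hM2⟩ := EReal.lt_iff_exists_real_btwn.1 hcon
    have haffM : ∀ q ∈ subdiff f, (f q.1).toReal + q.2 (x - q.1) ≤ M := by
      intro q hq
      exact_mod_cast (haff q hq).trans hM1.le
    -- lower semicontinuity
    obtain ⟨ρ, hρ, hball⟩ := Metric.eventually_nhds_iff.1 (hf.2.2.2 x M hM2)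
    set C := (f a).toReal - ‖astar‖ * ‖x - a‖ with hC
    set K := ‖astar‖ + 2 + |M - C| / ρ with hK
    have hq0 : 0 ≤ |M - C| / ρ := by positivity
    obtain ⟨q, hq, -, -, hq2⟩ := aux_approx' hf (a, astar) ha x K 1
      (by simp only [hK]; linarith) one_pos a hfa
    have hqt := ((aux_subdiff_iff hbot q.1 q.2).1 hq).1
    have h1 := aux_lower hbot (a, astar) ha x q.1 hqt
    have h2 := haffM q hq
    simp only at h1
    have h3 : (1 + |M - C| / ρ) * ‖x - q.1‖ ≤ M - C := by
      have : (1 + |M - C| / ρ) * ‖x - q.1‖ =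
        (K - 1) * ‖x - q.1‖ - ‖astar‖ * ‖x - q.1‖ := by rw [hK]; ring
      rw [this]
      linarith
    have hclose : ‖x - q.1‖ < ρ := by
      by_contra hge
      push Not at hge
      have h4 : (1 + |M - C| / ρ) * ρ ≤ (1 + |M - C| / ρ) * ‖x - q.1‖ :=
        mul_le_mul_of_nonneg_left hge (by positivity)
      have h5 : (1 + |M - C| / ρ) * ρ = ρ + |M - C| := by field_simp
      have := le_abs_self (M - C)
      linarith
    have h6 : (M : EReal) < f q.1 := @hball q.1 (by rw [dist_comm, dist_eq_norm]; exact hclose)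
    rw [← EReal.coe_toReal hqt (hbot _)] at h6
    norm_cast at h6
    have h7 : 0 ≤ (K - 1) * ‖x - q.1‖ := by
      apply mul_nonneg _ (norm_nonneg _)
      have := norm_nonneg astar
      rw [hK]; linarith
    linarith
  have hsup : ∀ x, gLimsup fs x ≤ f x := by
    intro x
    rcases eq_or_ne (f x) ⊤ with hx | hx
    · rw [hx]; exact le_top
    obtain ⟨u, hu, hu2⟩ := aux_diag fs x (f x).toReal (by
      intro δ hδ
      set C := (f a).toReal - ‖astar‖ * ‖x - a‖ with hC
      set B := |(f x).toReal - C| with hB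
      set K := ‖astar‖ + 1 + 2 * B / δ with hK
      have hq0 : 0 ≤ 2 * B / δ := by positivity
      obtain ⟨q, hq, hq1, -, -⟩ := aux_approx' hf (a, astar) ha x K 1
        (by simp only [hK]; linarith) one_pos x hx
      have hqt := ((aux_subdiff_iff hbot q.1 q.2).1 hq).1
      have h1 := aux_lower hbot (a, astar) ha x q.1 hqt
      simp only [sub_self, norm_zero, mul_zero, add_zero] at hq1 h1
      have hKn : 0 ≤ K * ‖x - q.1‖ := by
        apply mul_nonneg _ (norm_nonneg _)
        have := norm_nonneg astar
        rw [hK]; linarith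
      have h3 : (1 + 2 * B / δ) * ‖x - q.1‖ ≤ (f x).toReal - C := by
        have : (1 + 2 * B / δ) * ‖x - q.1‖ =
          K * ‖x - q.1‖ - ‖astar‖ * ‖x - q.1‖ := by rw [hK]; ring
        rw [this]
        linarith
      have hclose : ‖x - q.1‖ < δ / 2 := by
        by_contra hge
        push Not at hge
        have h4 : (1 + 2 * B / δ) * (δ / 2) ≤ (1 + 2 * B / δ) * ‖x - q.1‖ :=
          mul_le_mul_of_nonneg_left hge (by positivity)
        have h5 : (1 + 2 * B / δ) * (δ / 2) = δ / 2 + B := by field_simp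
        have := le_abs_self ((f x).toReal - C)
        linarith
      filter_upwards [hVup q hq δ hδ, hfin q hq,
        Metric.tendsto_nhds.1 (hxp q hq).1.2.1 (δ/2) (by positivity)] with n h4 h5 h6
      refine ⟨xs q n, ?_, ?_⟩
      · rw [dist_eq_norm] at h6
        have h7 : ‖xs q n - x‖ ≤ ‖xs q n - q.1‖ + ‖x - q.1‖ := by
          rw [show xs q n - x = (xs q n - q.1) - (x - q.1) by abel]; exact norm_sub_le _ _
        linarith
      · rw [← EReal.coe_toReal h5 ((hfs n).2.1 _)]
        norm_cast
        simp only [hVdef] at h4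
        linarith)
    refine (iInf₂_le u hu).trans ?_
    apply EReal.le_of_forall_lt_iff_le.1
    intro r hr
    rw [← EReal.coe_toReal hx (hbot _)] at hr
    have hr' : (f x).toReal < r := by exact_mod_cast hr
    apply limsup_le_of_le
    · isBoundedDefault
    filter_upwards [hu2 (r - (f x).toReal) (by linarith)] with n hn
    simpa using hn
  exact fun x => ⟨le_antisymm ((hle x).trans (hsup x)) (hinf x),
    le_antisymm (hsup x) ((hinf x).trans (hle x))⟩
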